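/- Let α ∈ ℝ \ {0} and k ∈ ℝ. Then the function Ψ_δ(t,x;k) satisfies: (a) i·∂Ψ_δ/∂t(t,x;k) = −∂²Ψ_δ/∂x²(t,x;k) for all t > 0 and x ∈ ℝ \ {0}; (b) for every t > 0 the one-sided limits lim_{x→0⁺} Ψ_δ(t,x;k) and lim_{x→0⁻} Ψ_δ(t,x;k) exist and are equal (call their common value Ψ_δ(t,0;k)); (c) for every t > 0, lim_{x→0⁺} ∂Ψ_δ/∂x(t,x;k) − lim_{x→0⁻} ∂Ψ_δ/∂x(t,x;k) = 2·α·Ψ_δ(t,0;k); (d) for every x ∈ ℝ \ {0}, lim_{t→0⁺} Ψ_δ(t,x;k) = exp(i·k·x). -/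

import Mathlib

/-- The modified error function `Λ(z) = exp(z²)·(1 − (2/√π)·∫₀^z exp(−ξ²) dξ)`,
where the integral is the complex line integral along the segment from `0` to `z`. -/
noncomputable def Lam (z : ℂ) : ℂ :=
  Complex.exp (z ^ 2) *
    (1 - (2 / (Real.sqrt Real.pi : ℂ)) * ∫ s in (0:ℝ)..1, z * Complex.exp (-((s : ℂ) * z) ^ 2))

/-- For `t > 0`, the principal square root of `i·t`, namely `√t·(1+i)/√2`. -/
noncomputable def sqrtit (t : ℝ) : ℂ :=
  (Real.sqrt t : ℂ) * (1 + Complex.I) / (Real.sqrt 2 : ℂ)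

/-- The free plane-wave solution `Ψ_free(t,x;k) = exp(i·k·x − i·k²·t)`. -/
noncomputable def psiFree (k t x : ℝ) : ℂ :=
  Complex.exp (Complex.I * k * x - Complex.I * k ^ 2 * t)

/-- `φ_δ(t,x;k)` from the explicit solution for the δ-potential of strength `2α`. -/
noncomputable def phiDelta (α k t x : ℝ) : ℂ :=
  ((α : ℂ) / (2 * ((α : ℂ) + Complex.I * k))) *
    Complex.exp (-(x : ℂ) ^ 2 / (4 * Complex.I * t)) *
    (Lam (((|x| : ℝ) : ℂ) / (2 * sqrtit t) + (α : ℂ) * sqrtit t)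
      - Lam (((|x| : ℝ) : ℂ) / (2 * sqrtit t) - Complex.I * k * sqrtit t))

/-- `Ψ_δ(t,x;k) = Ψ_free(t,x;k) + φ_δ(t,x;k) + φ_δ(t,−x;−k)`. -/
noncomputable def psiDelta (α k t x : ℝ) : ℂ :=
  psiFree k t x + phiDelta α k t x + phiDelta α (-k) t (-x)

/-- `φ_δ'(t,x;k)` from the explicit solution for the δ'-potential of strength `2/β`. -/
noncomputable def phiDelta' (β k t x : ℝ) : ℂ :=
  ((Real.sign x : ℂ) / (2 * ((β : ℂ) + Complex.I * k))) *
    Complex.exp (-(x : ℂ) ^ 2 / (4 * Complex.I * t)) *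
    ((β : ℂ) * Lam (((|x| : ℝ) : ℂ) / (2 * sqrtit t) + (β : ℂ) * sqrtit t)
      + Complex.I * k * Lam (((|x| : ℝ) : ℂ) / (2 * sqrtit t) - Complex.I * k * sqrtit t))

/-- `Ψ_δ'(t,x;k) = Ψ_free(t,x;k) + φ_δ'(t,x;k) + φ_δ'(t,−x;−k)`. -/
noncomputable def psiDelta' (β k t x : ℝ) : ℂ :=
  psiFree k t x + phiDelta' β k t x + phiDelta' β (-k) t (-x)

open Filter Topology

noncomputable def erfc (z : ℂ) : ℂ :=
  1 - (2 / (Real.sqrt Real.pi : ℂ)) * ∫ s in (0:ℝ)..1, z * Complex.exp (-((s : ℂ) * z) ^ 2)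

theorem Lam_eq (z : ℂ) : Lam z = Complex.exp (z ^ 2) * erfc z := rfl

theorem sqrt_pi_ne_zero : (Real.sqrt Real.pi : ℂ) ≠ 0 := by
  simp [Real.sqrt_eq_zero', Real.pi_pos]

theorem hasDerivAt_comp_ofReal_affine {F : ℂ → ℂ} {F' a b : ℂ} {s : ℝ}
    (hF : HasDerivAt F F' (a + s * b)) :
    HasDerivAt (fun s : ℝ => F (a + s * b)) (b * F') s := by
  have h : HasDerivAt (fun s : ℝ => a + (s : ℂ) * b) b s := by
    simpa using ((Complex.ofRealCLM.hasDerivAt (x := s)).mul_const b).const_add a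
  rw [mul_comm]
  exact hF.comp s h

theorem integral_segment_eq_sub {f F : ℂ → ℂ} (hf : Continuous f)
    (hF : ∀ w, HasDerivAt F (f w) w) (z : ℂ) :
    ∫ s in (0:ℝ)..1, z * f (s * z) = F z - F 0 := by
  have h := intervalIntegral.integral_eq_sub_of_hasDerivAt (a := 0) (b := 1)
    (fun s _ => hasDerivAt_comp_ofReal_affine (hF (0 + (s : ℂ) * z)))
    (Continuous.intervalIntegrable (by fun_prop) _ _)
  simpa using h

theorem hasDerivAt_erfc (z : ℂ) :
    HasDerivAt erfc (-(2 / (Real.sqrt Real.pi : ℂ)) * Complex.exp (-z ^ 2)) z := by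
  have hd : Differentiable ℂ (fun z : ℂ => Complex.exp (-z ^ 2)) := by fun_prop
  obtain ⟨F, hF⟩ := hd.isExactOn_univ
  have h : erfc = fun z => 1 - (2 / (Real.sqrt Real.pi : ℂ)) * (F z - F 0) := by
    funext w
    rw [erfc, integral_segment_eq_sub hd.continuous (fun w => hF w (Set.mem_univ w))]
  rw [h]
  simpa using (((hF z (Set.mem_univ z)).sub_const (F 0)).const_mul
    (2 / (Real.sqrt Real.pi : ℂ))).const_sub 1

theorem erfc_neg_add (z : ℂ) : erfc (-z) + erfc z = 2 := by
  simp only [erfc, mul_neg, neg_mul, intervalIntegral.integral_neg, neg_sq]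
  ring

theorem tendsto_erfc_ofReal : Tendsto (fun R : ℝ => erfc R) atTop (𝓝 0) := by
  have h1 : ∀ R : ℝ, erfc R =
      ((1 - 2 / Real.sqrt Real.pi * ∫ x in (0:ℝ)..R, Real.exp (-1 * x ^ 2) : ℝ) : ℂ) := by
    intro R
    have := intervalIntegral.mul_integral_comp_mul_left (a := 0) (b := 1)
      (f := fun x : ℝ => Real.exp (-1 * x ^ 2)) (c := R)
    rw [mul_zero, mul_one] at this
    rw [← this, erfc, intervalIntegral.integral_const_mul]
    simp only [Complex.ofReal_sub, Complex.ofReal_one, Complex.ofReal_mul, Complex.ofReal_div,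
      Complex.ofReal_ofNat, ← intervalIntegral.integral_ofReal]
    congr 4
    funext s
    push_cast
    ring_nf
  have h2 := MeasureTheory.intervalIntegral_tendsto_integral_Ioi 0
    (integrable_exp_neg_mul_sq one_pos).integrableOn tendsto_id
  rw [integral_gaussian_Ioi] at h2
  have h3 := (h2.const_mul (2 / Real.sqrt Real.pi)).const_sub 1
  have h4 : 1 - 2 / Real.sqrt Real.pi * (Real.sqrt (Real.pi / 1) / 2) = 0 := by
    have : Real.sqrt Real.pi ≠ 0 := by simp [Real.sqrt_eq_zero', Real.pi_pos]
    field_simp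
    simp
  rw [h4] at h3
  simp only [h1]
  have := (Complex.continuous_ofReal.tendsto 0).comp h3
  simpa [Function.comp_def] using this

theorem tendsto_erfc_add_ofReal (z : ℂ) : Tendsto (fun R : ℝ => erfc (z + R)) atTop (𝓝 0) := by
  set C : ℝ := ‖(2 / (Real.sqrt Real.pi : ℂ))‖
  have key : ∀ R : ℝ, ‖z‖ ≤ R → ‖erfc (z + R) - erfc R‖ ≤
      C * Real.exp (‖z‖ ^ 2 - (R - ‖z‖) ^ 2) * ‖z‖ := by
    intro R hR
    have := (convex_closedBall (R : ℂ) ‖z‖).norm_image_sub_le_of_norm_hasDerivWithin_le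
      (f := erfc) (fun w _ => (hasDerivAt_erfc w).hasDerivWithinAt)
      (C := C * Real.exp (‖z‖ ^ 2 - (R - ‖z‖) ^ 2)) (x := R) (y := z + R) ?_
      (by simp) (by simp)
    · simpa using this
    · intro w hw
      rw [norm_mul, norm_neg, Complex.norm_exp]
      refine mul_le_mul_of_nonneg_left (Real.exp_le_exp.2 ?_) (norm_nonneg _)
      rw [mem_closedBall_iff_norm] at hw
      have hre := (Complex.abs_re_le_norm (w - R)).trans hw
      have him := (Complex.abs_im_le_norm (w - R)).trans hw
      simp only [Complex.sub_re, Complex.sub_im, Complex.ofReal_re, Complex.ofReal_im,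
        sub_zero] at hre him
      have e : (-w ^ 2).re = w.im ^ 2 - w.re ^ 2 := by simp [sq]
      rw [e]
      have h1 : w.im ^ 2 ≤ ‖z‖ ^ 2 := sq_le_sq' (abs_le.1 him).1 (abs_le.1 him).2
      have h2 : (R - ‖z‖) ^ 2 ≤ w.re ^ 2 :=
        pow_le_pow_left₀ (by linarith) (by linarith [(abs_le.1 hre).1]) 2
      linarith
  have hlim : Tendsto (fun R : ℝ => C * Real.exp (‖z‖ ^ 2 - (R - ‖z‖) ^ 2) * ‖z‖) atTop (𝓝 0) := by
    have h1 : Tendsto (fun R : ℝ => (R - ‖z‖) ^ 2) atTop atTop :=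
      (tendsto_pow_atTop two_ne_zero).comp (tendsto_atTop_add_const_right _ (-‖z‖) tendsto_id)
    have h2 : Tendsto (fun R : ℝ => ‖z‖ ^ 2 - (R - ‖z‖) ^ 2) atTop atBot :=
      tendsto_atBot_add_const_left _ _ (tendsto_neg_atTop_atBot.comp h1)
    simpa using ((Real.tendsto_exp_atBot.comp h2).const_mul C).mul_const ‖z‖
  have hsub : Tendsto (fun R : ℝ => erfc (z + R) - erfc R) atTop (𝓝 0) :=
    squeeze_zero_norm' ((eventually_ge_atTop ‖z‖).mono key) hlim
  simpa using hsub.add tendsto_erfc_ofReal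

theorem norm_Lam_le {z : ℂ} (hz : 0 < z.re) : ‖Lam z‖ ≤ 1 / (Real.sqrt Real.pi * z.re) := by
  have hpi : 0 < Real.sqrt Real.pi := Real.sqrt_pos.2 Real.pi_pos
  have hd : ∀ s : ℝ, HasDerivAt (fun s : ℝ => Complex.exp (z ^ 2) * (erfc (z + s) - erfc z))
      (Complex.exp (z ^ 2) * (-(2 / (Real.sqrt Real.pi : ℂ)) * Complex.exp (-(z + s) ^ 2))) s := by
    intro s
    have h := hasDerivAt_comp_ofReal_affine (hasDerivAt_erfc (z + s * 1))
    simpa using (h.sub_const (erfc z)).const_mul (Complex.exp (z ^ 2))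
  set B : ℝ → ℝ := fun s => (1 - Real.exp (-(2 * z.re) * s)) / (Real.sqrt Real.pi * z.re)
  have hB : ∀ s : ℝ, HasDerivAt B (2 / Real.sqrt Real.pi * Real.exp (-(2 * z.re) * s)) s := by
    intro s
    have h1 : HasDerivAt (fun s : ℝ => -(2 * z.re) * s) (-(2 * z.re)) s := by
      simpa using (hasDerivAt_id s).const_mul (-(2 * z.re))
    have h2 := (h1.exp.const_sub 1).div_const (Real.sqrt Real.pi * z.re)
    exact h2.congr_deriv (by field_simp)
  have hle : ∀ R : ℝ, 0 ≤ R →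
      ‖Complex.exp (z ^ 2) * (erfc (z + R) - erfc z)‖ ≤ 1 / (Real.sqrt Real.pi * z.re) := by
    intro R hR
    have := image_norm_le_of_norm_deriv_right_le_deriv_boundary (a := 0) (b := R)
      (f := fun s : ℝ => Complex.exp (z ^ 2) * (erfc (z + s) - erfc z))
      (fun s _ => (hd s).continuousAt.continuousWithinAt)
      (fun s _ => (hd s).hasDerivWithinAt) (B := B) (by simp [B]) hB ?_ (x := R) ⟨hR, le_rfl⟩
    · refine this.trans ?_
      have := Real.exp_pos (-(2 * z.re) * R)
      simp only [B]
      gcongr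
      linarith
    · intro s hs
      rw [mul_left_comm, ← Complex.exp_add, norm_mul, norm_neg, Complex.norm_exp]
      have e : (z ^ 2 + -(z + (s : ℂ)) ^ 2).re = -(2 * z.re) * s - s ^ 2 := by
        simp [sq]
        ring
      rw [e]
      have e2 : ‖(2 / (Real.sqrt Real.pi : ℂ))‖ = 2 / Real.sqrt Real.pi := by
        simp [abs_of_pos hpi]
      rw [e2]
      gcongr
      nlinarith [sq_nonneg s]
  have hlim := ((tendsto_erfc_add_ofReal z).sub_const (erfc z)).const_mul (Complex.exp (z ^ 2))
  have := le_of_tendsto hlim.norm ((eventually_ge_atTop 0).mono hle)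
  simpa [Lam_eq] using this

theorem sqrtit_sq {t : ℝ} (ht : 0 ≤ t) : sqrtit t ^ 2 = Complex.I * t := by
  have h1 : (Real.sqrt t : ℂ) ^ 2 = t := by
    exact_mod_cast congrArg Complex.ofReal (Real.sq_sqrt ht)
  have h2 : (Real.sqrt 2 : ℂ) ^ 2 = 2 := by
    exact_mod_cast congrArg Complex.ofReal (Real.sq_sqrt (zero_le_two (α := ℝ)))
  rw [sqrtit, div_pow, mul_pow, h1, h2]
  linear_combination (t / 2 : ℂ) * Complex.I_sq

theorem sqrtit_ne_zero {t : ℝ} (ht : 0 < t) : sqrtit t ≠ 0 := by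
  intro h
  have := sqrtit_sq ht.le
  simp [h, ht.ne'] at this

theorem hasDerivAt_sqrtit {t : ℝ} (ht : 0 < t) :
    HasDerivAt sqrtit (Complex.I / (2 * sqrtit t)) t := by
  have h1 := (((Real.hasDerivAt_sqrt ht.ne').ofReal_comp).mul_const (1 + Complex.I)).div_const
    (Real.sqrt 2 : ℂ)
  refine h1.congr_deriv ?_
  have h2 : (Real.sqrt t : ℂ) ≠ 0 := by exact_mod_cast (Real.sqrt_pos.2 ht).ne'
  have hs := sqrtit_sq ht.le
  have hq := sqrtit_ne_zero ht
  have h3 : (Real.sqrt t : ℂ) ^ 2 = t := by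
    exact_mod_cast congrArg Complex.ofReal (Real.sq_sqrt ht.le)
  rw [eq_div_iff (by simpa using hq)]
  have h4 : sqrtit t = Real.sqrt t * (1 + Complex.I) / Real.sqrt 2 := rfl
  rw [← h3] at hs
  push_cast
  calc 1 / (2 * (Real.sqrt t : ℂ)) * (1 + Complex.I) / Real.sqrt 2 * (2 * sqrtit t)
      = (Real.sqrt t * (1 + Complex.I) / Real.sqrt 2) * sqrtit t / Real.sqrt t ^ 2 := by
        field_simp
    _ = sqrtit t ^ 2 / Real.sqrt t ^ 2 := by rw [← h4]; ring
    _ = Complex.I := by rw [hs]; field_simp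

/-- The solution `exp(ωr + iω²t)·erfc(r/(2√(it)) + ω√(it))` of the free equation. -/
noncomputable def erfcWave (ω : ℂ) (t r : ℝ) : ℂ :=
  Complex.exp (ω * r + Complex.I * ω ^ 2 * t) * erfc (r / (2 * sqrtit t) + ω * sqrtit t)

/-- The normalized free Schrödinger kernel. -/
noncomputable def heatKernel (t r : ℝ) : ℂ :=
  Complex.exp (-(r : ℂ) ^ 2 / (4 * Complex.I * t)) / (Real.sqrt Real.pi * sqrtit t)

theorem erfcWave_arg_sq {t : ℝ} (ht : 0 < t) (ω : ℂ) (r : ℝ) :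
    ((r : ℂ) / (2 * sqrtit t) + ω * sqrtit t) ^ 2 =
      ω * r + Complex.I * ω ^ 2 * t - -(r : ℂ) ^ 2 / (4 * Complex.I * t) := by
  have hq := sqrtit_ne_zero ht
  have h : (4 * Complex.I * t : ℂ) = 4 * sqrtit t ^ 2 := by rw [sqrtit_sq ht.le]; ring
  have h' : (Complex.I * ω ^ 2 * t : ℂ) = ω ^ 2 * sqrtit t ^ 2 := by rw [sqrtit_sq ht.le]; ring
  rw [h, h']
  field_simp
  ring

theorem exp_mul_Lam {t : ℝ} (ht : 0 < t) (ω : ℂ) (r : ℝ) :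
    Complex.exp (-(r : ℂ) ^ 2 / (4 * Complex.I * t)) *
      Lam (r / (2 * sqrtit t) + ω * sqrtit t) = erfcWave ω t r := by
  rw [Lam_eq, erfcWave, erfcWave_arg_sq ht, ← mul_assoc, ← Complex.exp_add, add_sub_cancel]

theorem exp_mul_gaussian {t : ℝ} (ht : 0 < t) (ω : ℂ) (r : ℝ) :
    Complex.exp (ω * r + Complex.I * ω ^ 2 * t) *
      (-(2 / (Real.sqrt Real.pi : ℂ)) *
        Complex.exp (-((r : ℂ) / (2 * sqrtit t) + ω * sqrtit t) ^ 2)) =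
      -(2 * sqrtit t) * heatKernel t r := by
  have hq := sqrtit_ne_zero ht
  have hpi := sqrt_pi_ne_zero
  rw [heatKernel, erfcWave_arg_sq ht, mul_left_comm, ← Complex.exp_add, neg_sub, add_sub_cancel]
  field_simp

theorem hasDerivAt_erfcWave_space {t : ℝ} (ht : 0 < t) (ω : ℂ) (r : ℝ) :
    HasDerivAt (erfcWave ω t) (ω * erfcWave ω t r - heatKernel t r) r := by
  have hq := sqrtit_ne_zero ht
  have hr : HasDerivAt (fun r : ℝ => (r : ℂ)) 1 r := Complex.ofRealCLM.hasDerivAt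
  have h1 := ((hr.const_mul ω).add_const (Complex.I * ω ^ 2 * t)).cexp
  have h2 := (hasDerivAt_erfc _).comp r ((hr.div_const (2 * sqrtit t)).add_const (ω * sqrtit t))
  refine (h1.mul h2).congr_deriv ?_
  have h3 := exp_mul_gaussian ht ω r
  simp only [Function.comp_def, erfcWave]
  rw [← mul_assoc (Complex.exp _) (-(2 / _) * _), h3]
  field_simp
  ring

theorem hasDerivAt_heatKernel_space (t r : ℝ) :
    HasDerivAt (heatKernel t) (-(2 * r) / (4 * Complex.I * t) * heatKernel t r) r := by
  have hr : HasDerivAt (fun r : ℝ => (r : ℂ)) 1 r := Complex.ofRealCLM.hasDerivAt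
  refine ((((hr.pow 2).neg.div_const (4 * Complex.I * t)).cexp).div_const
    (Real.sqrt Real.pi * sqrtit t)).congr_deriv ?_
  simp [heatKernel]
  ring

theorem hasDerivAt_erfcWave_time {t : ℝ} (ht : 0 < t) (ω : ℂ) (r : ℝ) :
    HasDerivAt (fun τ => erfcWave ω τ r)
      (Complex.I * ω ^ 2 * erfcWave ω t r
        - Complex.I * (ω - r / (2 * Complex.I * t)) * heatKernel t r) t := by
  have hq := sqrtit_ne_zero ht
  have hτ : HasDerivAt (fun τ : ℝ => (τ : ℂ)) 1 t := Complex.ofRealCLM.hasDerivAt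
  have hs := hasDerivAt_sqrtit ht
  have h1 := ((hτ.const_mul (Complex.I * ω ^ 2)).const_add (ω * r)).cexp
  have h2 := (hasDerivAt_erfc _).comp t
    (((hs.const_mul 2).fun_inv (by simpa using hq)).const_mul (r : ℂ) |>.add (hs.const_mul ω))
  simp only [Function.comp_def, ← div_eq_mul_inv] at h2
  refine (h1.mul h2).congr_deriv ?_
  have h3 := exp_mul_gaussian ht ω r
  simp only [erfcWave, Pi.add_apply]
  rw [← mul_assoc (Complex.exp _) (-(2 / _) * _), h3]
  have h : (2 * Complex.I * t : ℂ) = 2 * sqrtit t ^ 2 := by rw [sqrtit_sq ht.le]; ring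
  rw [h]
  field_simp
  ring

theorem erfcWave_neg_add {t : ℝ} (ω : ℂ) :
    erfcWave (-ω) t 0 + erfcWave ω t 0 = 2 * Complex.exp (Complex.I * ω ^ 2 * t) := by
  have := erfc_neg_add (ω * sqrtit t)
  simp only [erfcWave, Complex.ofReal_zero, mul_zero, zero_div, zero_add, neg_sq, neg_mul]
  rw [← mul_add, this, mul_comm]

theorem tendsto_erfcWave_zero (ω : ℂ) {r : ℝ} (hr : 0 < r) :
    Tendsto (fun t => erfcWave ω t r) (𝓝[>] 0) (𝓝 0) := by
  set c : ℂ := (1 + Complex.I) / (Real.sqrt 2 : ℂ) with hc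
  have h2 : (0 : ℝ) < Real.sqrt 2 := by positivity
  have hsq : (Real.sqrt 2 : ℂ) ≠ 0 := by exact_mod_cast h2.ne'
  have hcinv : (2 * c)⁻¹ = (((Real.sqrt 2) / 4 : ℝ) : ℂ) * (1 - Complex.I) := by
    refine inv_eq_of_mul_eq_one_left ?_
    rw [hc]
    push_cast
    field_simp
    linear_combination (-2 : ℂ) * Complex.I_sq
  -- the argument of `erfc`, rescaled by `√t`
  set g : ℝ → ℝ := fun t => ((r : ℂ) * (2 * c)⁻¹ + ω * c * t).re with hg
  have hg0 : g 0 = r * (Real.sqrt 2 / 4) := by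
    simp only [hg, hcinv]
    simp
  have hgpos : 0 < g 0 := by rw [hg0]; positivity
  have hgc : Continuous g := by fun_prop
  have hbound : ∀ᶠ t in 𝓝[>] (0 : ℝ),
      ‖erfcWave ω t r‖ ≤ Real.sqrt t / (Real.sqrt Real.pi * g t) := by
    filter_upwards [self_mem_nhdsWithin,
      mem_nhdsWithin_of_mem_nhds (hgc.continuousAt.eventually_const_lt hgpos)] with t ht hgt
    rw [Set.mem_Ioi] at ht
    have hst : 0 < Real.sqrt t := Real.sqrt_pos.2 ht
    have hstc : (Real.sqrt t : ℂ) ≠ 0 := by exact_mod_cast hst.ne'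
    have hz : ((r : ℂ) / (2 * sqrtit t) + ω * sqrtit t) =
        ((Real.sqrt t)⁻¹ : ℝ) * ((r : ℂ) * (2 * c)⁻¹ + ω * c * t) := by
      have hq : sqrtit t = Real.sqrt t * c := by rw [sqrtit, hc]; ring
      have ht' : (t : ℂ) = (Real.sqrt t : ℂ) ^ 2 := by
        exact_mod_cast (congrArg Complex.ofReal (Real.sq_sqrt ht.le)).symm
      rw [hq, ht']
      push_cast
      field_simp
    have hre : ((r : ℂ) / (2 * sqrtit t) + ω * sqrtit t).re = (Real.sqrt t)⁻¹ * g t := by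
      rw [hz, Complex.re_ofReal_mul]
    have hphase : ‖Complex.exp (-(r : ℂ) ^ 2 / (4 * Complex.I * t))‖ = 1 := by
      have : -(r : ℂ) ^ 2 / (4 * Complex.I * t) = ((r ^ 2 / (4 * t) : ℝ) : ℂ) * Complex.I := by
        have : (t : ℂ) ≠ 0 := by exact_mod_cast ht.ne'
        push_cast
        field_simp
        linear_combination (-(r : ℂ) ^ 2) * Complex.I_sq
      rw [this, Complex.norm_exp_ofReal_mul_I]
    rw [← exp_mul_Lam ht, norm_mul, hphase, one_mul]
    refine (norm_Lam_le (by rw [hre]; positivity)).trans_eq ?_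
    rw [hre]
    field_simp
  have hlim : Tendsto (fun t => Real.sqrt t / (Real.sqrt Real.pi * g t)) (𝓝[>] 0) (𝓝 0) := by
    have hne : Real.sqrt Real.pi * g 0 ≠ 0 :=
      mul_ne_zero (Real.sqrt_pos.2 Real.pi_pos).ne' hgpos.ne'
    have : ContinuousAt (fun t => Real.sqrt t / (Real.sqrt Real.pi * g t)) 0 :=
      (Real.continuous_sqrt.continuousAt).div (by fun_prop) hne
    simpa [ContinuousAt] using this.tendsto.mono_left nhdsWithin_le_nhds
  exact squeeze_zero_norm' hbound hlim

/-- The scattered part of `Ψ_δ`, as a function of `r = |x|`. -/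
noncomputable def scattered (α k t r : ℝ) : ℂ :=
  α / (2 * (α + Complex.I * k)) * (erfcWave α t r - erfcWave (-(Complex.I * k)) t r) +
  α / (2 * (α - Complex.I * k)) * (erfcWave α t r - erfcWave (Complex.I * k) t r)

/-- The `r`-derivative of `scattered`. -/
noncomputable def scatteredDeriv (α k t r : ℝ) : ℂ :=
  α / (2 * (α + Complex.I * k)) *
    (α * erfcWave α t r + Complex.I * k * erfcWave (-(Complex.I * k)) t r) +
  α / (2 * (α - Complex.I * k)) *
    (α * erfcWave α t r - Complex.I * k * erfcWave (Complex.I * k) t r)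

theorem phiDelta_eq {t : ℝ} (ht : 0 < t) (α k x : ℝ) :
    phiDelta α k t x = α / (2 * (α + Complex.I * k)) *
      (erfcWave α t |x| - erfcWave (-(Complex.I * k)) t |x|) := by
  have hx : (x : ℂ) ^ 2 = ((|x| : ℝ) : ℂ) ^ 2 := by
    rw [← Complex.ofReal_pow, ← Complex.ofReal_pow, sq_abs]
  rw [← exp_mul_Lam ht, ← exp_mul_Lam ht, phiDelta, hx]
  ring_nf

theorem psiDelta_eq {t : ℝ} (ht : 0 < t) (α k x : ℝ) :
    psiDelta α k t x = psiFree k t x + scattered α k t |x| := by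
  rw [psiDelta, phiDelta_eq ht, phiDelta_eq ht, abs_neg, scattered]
  push_cast
  ring_nf

theorem hasDerivAt_scattered {t : ℝ} (ht : 0 < t) (α k r : ℝ) :
    HasDerivAt (scattered α k t) (scatteredDeriv α k t r) r := by
  have h := hasDerivAt_erfcWave_space ht (r := r)
  refine ((((h α).sub (h _)).const_mul _).add (((h α).sub (h _)).const_mul _)).congr_deriv ?_
  rw [scatteredDeriv]
  ring

theorem exists_hasDerivAt_scattered {t : ℝ} (ht : 0 < t) (α k r : ℝ) :
    ∃ u v : ℂ, HasDerivAt (scatteredDeriv α k t) u r ∧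
      HasDerivAt (fun τ => scattered α k τ r) v t ∧ Complex.I * v = -u := by
  have h := hasDerivAt_erfcWave_space ht (r := r)
  have h' := hasDerivAt_erfcWave_time ht (r := r)
  refine ⟨_, _,
    ((((h α).const_mul _).add ((h _).const_mul _)).const_mul _).add
      ((((h α).const_mul _).sub ((h _).const_mul _)).const_mul _),
    (((h' α).sub (h' _)).const_mul _).add (((h' α).sub (h' _)).const_mul _), ?_⟩
  linear_combination (α / (2 * (α + Complex.I * k)) * (α ^ 2 * erfcWave α t r
      - (Complex.I * k) ^ 2 * erfcWave (-(Complex.I * k)) t r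
      - (α + Complex.I * k) * heatKernel t r) +
    α / (2 * (α - Complex.I * k)) * (α ^ 2 * erfcWave α t r
      - (Complex.I * k) ^ 2 * erfcWave (Complex.I * k) t r
      - (α - Complex.I * k) * heatKernel t r)) * Complex.I_sq

theorem scatteredDeriv_zero {α : ℝ} (hα : α ≠ 0) (k t : ℝ) :
    scatteredDeriv α k t 0 = α * (psiFree k t 0 + scattered α k t 0) := by
  have hne : ∀ k : ℝ, (α : ℂ) + Complex.I * k ≠ 0 := by
    intro k h
    exact hα (by simpa using congrArg Complex.re h)
  have h1 := hne k
  have h2 : (α : ℂ) - Complex.I * k ≠ 0 := by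
    simpa [sub_eq_add_neg] using hne (-k)
  have h3 := erfcWave_neg_add (t := t) (Complex.I * k)
  have h4 : psiFree k t 0 = Complex.exp (Complex.I * (Complex.I * k) ^ 2 * t) := by
    rw [psiFree, mul_pow, Complex.I_sq]
    congr 1
    push_cast
    ring
  rw [← h4] at h3
  have h5 : psiFree k t 0 = (erfcWave (-(Complex.I * k)) t 0 + erfcWave (Complex.I * k) t 0) / 2 := by
    rw [h3]
    ring
  rw [scatteredDeriv, scattered, h5]
  field_simp
  ring

theorem hasDerivAt_psiFree_space (k t x : ℝ) :
    HasDerivAt (psiFree k t) (Complex.I * k * psiFree k t x) x := by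
  have hx : HasDerivAt (fun x : ℝ => (x : ℂ)) 1 x := Complex.ofRealCLM.hasDerivAt
  refine ((hx.const_mul (Complex.I * k)).sub_const (Complex.I * k ^ 2 * t)).cexp.congr_deriv ?_
  rw [psiFree]
  ring

theorem hasDerivAt_psiFree_time (k t x : ℝ) :
    HasDerivAt (fun τ => psiFree k τ x) (-(Complex.I * k ^ 2) * psiFree k t x) t := by
  have ht : HasDerivAt (fun t : ℝ => (t : ℂ)) 1 t := Complex.ofRealCLM.hasDerivAt
  refine ((ht.const_mul (Complex.I * k ^ 2)).const_sub (Complex.I * k * x)).cexp.congr_deriv ?_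
  rw [psiFree]
  ring

theorem ofReal_signType_coe (s : SignType) : (((s : ℝ)) : ℂ) = (s : ℂ) := by
  cases s <;> simp

theorem hasDerivAt_psiDelta {t : ℝ} (ht : 0 < t) (α k : ℝ) {x : ℝ} (hx : x ≠ 0) :
    HasDerivAt (psiDelta α k t)
      (Complex.I * k * psiFree k t x + SignType.sign x * scatteredDeriv α k t |x|) x := by
  have h : psiDelta α k t = fun y => psiFree k t y + scattered α k t |y| :=
    funext (psiDelta_eq ht α k)
  rw [h]
  refine ((hasDerivAt_psiFree_space k t x).add
    ((hasDerivAt_scattered ht α k |x|).scomp x (hasDerivAt_abs hx))).congr_deriv ?_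
  rw [Complex.real_smul, ofReal_signType_coe]

theorem schroedinger_psiDelta {t : ℝ} (ht : 0 < t) (α k : ℝ) {x : ℝ} (hx : x ≠ 0) :
    Complex.I * deriv (fun τ : ℝ => psiDelta α k τ x) t =
      -iteratedDeriv 2 (fun y : ℝ => psiDelta α k t y) x := by
  obtain ⟨u, v, hu, hv, huv⟩ := exists_hasDerivAt_scattered ht α k |x|
  have htime : deriv (fun τ : ℝ => psiDelta α k τ x) t =
      -(Complex.I * k ^ 2) * psiFree k t x + v := by
    have h : (fun τ : ℝ => psiDelta α k τ x) =ᶠ[𝓝 t]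
        fun τ => psiFree k τ x + scattered α k τ |x| := by
      filter_upwards [lt_mem_nhds ht] with τ hτ using psiDelta_eq hτ α k x
    exact (((hasDerivAt_psiFree_time k t x).add hv).congr_of_eventuallyEq h).deriv
  have hspace : deriv (deriv (psiDelta α k t)) x = (Complex.I * k) ^ 2 * psiFree k t x + u := by
    set σ : ℂ := ((SignType.sign x : SignType) : ℂ) with hσ
    have hσ2 : σ * σ = 1 := by
      rcases lt_or_gt_of_ne hx with h | h <;> simp [hσ, h]
    have h : deriv (psiDelta α k t) =ᶠ[𝓝 x]
        fun y => Complex.I * k * psiFree k t y + σ * scatteredDeriv α k t |y| := by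
      have hs : ∀ᶠ y in 𝓝 x, SignType.sign y = SignType.sign x := by
        rcases lt_or_gt_of_ne hx with h | h
        · filter_upwards [gt_mem_nhds h] with y hy
          rw [sign_neg hy, sign_neg h]
        · filter_upwards [lt_mem_nhds h] with y hy
          rw [sign_pos hy, sign_pos h]
      filter_upwards [hs, isOpen_ne.mem_nhds hx] with y hy hy0
      rw [(hasDerivAt_psiDelta ht α k hy0).deriv, hy]
    have h2 := ((hasDerivAt_psiFree_space k t x).const_mul (Complex.I * k)).add
      ((hu.scomp x (hasDerivAt_abs hx)).const_mul σ)
    rw [(h2.congr_of_eventuallyEq h).deriv]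
    have hsm : ((SignType.sign x : SignType) : ℝ) • u = σ * u := by
      rw [Complex.real_smul, ofReal_signType_coe]
    rw [hsm]
    linear_combination u * hσ2
  rw [htime, iteratedDeriv_succ, iteratedDeriv_one]
  change _ = -deriv (deriv (psiDelta α k t)) x
  rw [hspace]
  linear_combination huv

theorem tendsto_psiDelta_initial (α k : ℝ) {x : ℝ} (hx : x ≠ 0) :
    Tendsto (fun t : ℝ => psiDelta α k t x) (𝓝[>] 0) (𝓝 (Complex.exp (Complex.I * k * x))) := by
  have hr := abs_pos.2 hx
  have hfree : Tendsto (fun t : ℝ => psiFree k t x) (𝓝[>] 0)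
      (𝓝 (Complex.exp (Complex.I * k * x))) := by
    have : ContinuousAt (fun t : ℝ => psiFree k t x) 0 :=
      (hasDerivAt_psiFree_time k 0 x).continuousAt
    simpa [ContinuousAt, psiFree] using this.tendsto.mono_left nhdsWithin_le_nhds
  have hw := fun ω => tendsto_erfcWave_zero ω hr
  have hscat : Tendsto (fun t => scattered α k t |x|) (𝓝[>] 0) (𝓝 0) := by
    simpa [scattered] using
      (((hw α).sub (hw (-(Complex.I * k)))).const_mul (α / (2 * (α + Complex.I * k) : ℂ))).add
        (((hw α).sub (hw (Complex.I * k))).const_mul (α / (2 * (α - Complex.I * k) : ℂ)))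
  have h := hfree.add hscat
  rw [add_zero] at h
  refine h.congr' ?_
  filter_upwards [self_mem_nhdsWithin] with t ht using (psiDelta_eq ht α k x).symm

/-- `Ψ_δ` solves the Schrödinger equation with a δ-potential of strength `2α`:
(a) the free equation away from `x = 0`; (b) continuity at `x = 0`;
(c) the jump condition `∂ₓΨ(t,0⁺) − ∂ₓΨ(t,0⁻) = 2αΨ(t,0)`;
(d) the initial condition `Ψ(0⁺,x) = exp(ikx)`. -/
theorem psiDelta_solves_delta_schroedinger (α k : ℝ) (hα : α ≠ 0) :
    (∀ t : ℝ, 0 < t → ∀ x : ℝ, x ≠ 0 →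
      Complex.I * deriv (fun τ : ℝ => psiDelta α k τ x) t =
        - iteratedDeriv 2 (fun y : ℝ => psiDelta α k t y) x) ∧
    (∀ t : ℝ, 0 < t → ∃ L Dp Dm : ℂ,
      Tendsto (fun x : ℝ => psiDelta α k t x) (nhdsWithin 0 (Set.Ioi 0)) (nhds L) ∧
      Tendsto (fun x : ℝ => psiDelta α k t x) (nhdsWithin 0 (Set.Iio 0)) (nhds L) ∧
      Tendsto (fun x : ℝ => deriv (fun y : ℝ => psiDelta α k t y) x)
        (nhdsWithin 0 (Set.Ioi 0)) (nhds Dp) ∧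
      Tendsto (fun x : ℝ => deriv (fun y : ℝ => psiDelta α k t y) x)
        (nhdsWithin 0 (Set.Iio 0)) (nhds Dm) ∧
      Dp - Dm = 2 * (α : ℂ) * L) ∧
    (∀ x : ℝ, x ≠ 0 →
      Tendsto (fun t : ℝ => psiDelta α k t x) (nhdsWithin 0 (Set.Ioi 0))
        (nhds (Complex.exp (Complex.I * k * x)))) := by
  refine ⟨fun t ht x hx => schroedinger_psiDelta ht α k hx, fun t ht => ?_,
    fun x hx => tendsto_psiDelta_initial α k hx⟩
  have hfree : Continuous (psiFree k t) :=
    continuous_iff_continuousAt.2 fun x => (hasDerivAt_psiFree_space k t x).continuousAt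
  have hscat : Continuous (scattered α k t) :=
    continuous_iff_continuousAt.2 fun r => (hasDerivAt_scattered ht α k r).continuousAt
  have hderiv : Continuous (scatteredDeriv α k t) := by
    refine continuous_iff_continuousAt.2 fun r => ?_
    obtain ⟨u, v, hu, -⟩ := exists_hasDerivAt_scattered ht α k r
    exact hu.continuousAt
  have hpsi : Tendsto (psiDelta α k t) (𝓝 0) (𝓝 (psiFree k t 0 + scattered α k t 0)) := by
    rw [funext (psiDelta_eq ht α k)]
    exact (by fun_prop : Continuous fun y : ℝ => psiFree k t y + scattered α k t |y|).tendsto' _ _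
      (by simp)
  refine ⟨psiFree k t 0 + scattered α k t 0,
    Complex.I * k * psiFree k t 0 + scatteredDeriv α k t 0,
    Complex.I * k * psiFree k t 0 - scatteredDeriv α k t 0,
    hpsi.mono_left nhdsWithin_le_nhds, hpsi.mono_left nhdsWithin_le_nhds, ?_, ?_, ?_⟩
  · have h : Continuous fun x : ℝ =>
        Complex.I * k * psiFree k t x + scatteredDeriv α k t |x| := by fun_prop
    refine ((h.tendsto' 0 _ (by simp)).mono_left nhdsWithin_le_nhds).congr' ?_
    filter_upwards [self_mem_nhdsWithin] with x hx
    rw [(hasDerivAt_psiDelta ht α k (ne_of_gt hx)).deriv, sign_pos hx]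
    simp
  · have h : Continuous fun x : ℝ =>
        Complex.I * k * psiFree k t x - scatteredDeriv α k t |x| := by fun_prop
    refine ((h.tendsto' 0 _ (by simp)).mono_left nhdsWithin_le_nhds).congr' ?_
    filter_upwards [self_mem_nhdsWithin] with x hx
    rw [(hasDerivAt_psiDelta ht α k (ne_of_lt hx)).deriv, sign_neg hx]
    simp [sub_eq_add_neg]
  · rw [scatteredDeriv_zero hα]
    ring
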